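/- For all integers k > d ≥ 1 with (k,d) ≠ (2,1), there is no k to d cubical cut and project set which is LR with respect to the collection 𝒞_d of convex polytopes in ℝ^d with nonempty interior and vertices in ℤ^d. -/

import Mathlib

noncomputable section

open MeasureTheory Set Filter

/-- The distance from a real number to the nearest integer. -/
def distInt (x : ℝ) : ℝ := |x - round x|

/-- The real vector in `ℝ^k` corresponding to an integer vector. -/
def intVec {k : ℕ} (n : Fin k → ℤ) : Fin k → ℝ := fun i => (n i : ℝ)

/-- The embedding of `ℝ^d` into `ℝ^k` as the span of the first `d` coordinates. -/
def emb (k d : ℕ) (x : Fin d → ℝ) : Fin k → ℝ :=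
  fun i => if h : (i : ℕ) < d then x ⟨i, h⟩ else 0

/-- A `k` to `d` cut and project scheme: a totally irrational `d`-dimensional subspace
`E ⊆ ℝ^k`, the projection `proj = π` onto `E` along a complementary subspace `F_π`
(injective on `ℤ^k`), the projection `rho = ρ` onto `E` with respect to the decomposition
`ℝ^k = E + F_ρ` where `F_ρ = {0} × ℝ^{k-d}`, a window `W ⊆ F_ρ`, and a point `s`
(a representative of a point of `ℝ^k/ℤ^k`). -/
structure CPS (k d : ℕ) where
  E : Submodule ℝ (Fin k → ℝ)
  rank_E : Module.finrank ℝ E = d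
  /-- `E` is totally irrational: its image in `ℝ^k/ℤ^k` is dense,
  equivalently `E + ℤ^k` is dense in `ℝ^k`. -/
  totallyIrrational : Dense {x : Fin k → ℝ | ∃ e ∈ E, ∃ n : Fin k → ℤ, x = e + intVec n}
  /-- `π`, the projection onto `E` along a complementary subspace `F_π = ker proj`. -/
  proj : (Fin k → ℝ) →ₗ[ℝ] (Fin k → ℝ)
  proj_mem : ∀ x, proj x ∈ E
  proj_id : ∀ x ∈ E, proj x = x
  /-- `π` is injective on `ℤ^k`. -/
  proj_inj : ∀ m n : Fin k → ℤ, proj (intVec m) = proj (intVec n) → m = n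
  /-- `ρ`, the projection onto `E` with respect to the decomposition `ℝ^k = E + F_ρ`. -/
  rho : (Fin k → ℝ) →ₗ[ℝ] (Fin k → ℝ)
  rho_mem : ∀ x, rho x ∈ E
  /-- `x - ρ(x) ∈ F_ρ = {0} × ℝ^{k-d}`; in particular `ρ* = id - ρ` maps into `F_ρ`. -/
  rho_decomp : ∀ (x : Fin k → ℝ) (i : Fin k), (i : ℕ) < d → x i - rho x i = 0
  /-- The window `W ⊆ F_ρ`. -/
  window : Set (Fin k → ℝ)
  window_sub : ∀ x ∈ window, ∀ i : Fin k, (i : ℕ) < d → x i = 0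
  /-- A representative of the point `s ∈ ℝ^k/ℤ^k`. -/
  s : Fin k → ℝ

namespace CPS

variable {k d : ℕ} (𝒟 : CPS k d)

/-- `ρ* : ℝ^k → F_ρ`, the projection onto `F_ρ` along `E`. -/
def rhoStar (x : Fin k → ℝ) : Fin k → ℝ := x - 𝒟.rho x

/-- The strip `S = W + E`. -/
def strip : Set (Fin k → ℝ) := {z | ∃ w ∈ 𝒟.window, ∃ e ∈ (𝒟.E : Set (Fin k → ℝ)), z = w + e}

/-- The cut and project set `Y = π(S ∩ (ℤ^k + s))`. -/
def Y : Set (Fin k → ℝ) :=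
  𝒟.proj '' (𝒟.strip ∩ {z | ∃ n : Fin k → ℤ, z = intVec n + 𝒟.s})

/-- `s` is regular: `ℤ^k + s` does not meet the boundary of the strip. -/
def Regular : Prop := ∀ n : Fin k → ℤ, intVec n + 𝒟.s ∉ frontier 𝒟.strip

/-- `Y` is aperiodic: its group of periods is trivial. -/
def Aperiodic : Prop := ∀ x ∈ (𝒟.E : Set (Fin k → ℝ)),
  {z | ∃ y ∈ 𝒟.Y, z = y + x} = 𝒟.Y → x = 0

/-- The window is the cubical window `{Σ_{i=d+1}^k t_i e_i : 0 ≤ t_i < 1}`. -/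
def IsCubical : Prop :=
  𝒟.window = {x : Fin k → ℝ | ∀ i : Fin k,
    if (i : ℕ) < d then x i = 0 else 0 ≤ x i ∧ x i < 1}

/-- The window is the canonical window `ρ*([0,1]^k)`. -/
def IsCanonical : Prop :=
  𝒟.window = 𝒟.rhoStar '' {x : Fin k → ℝ | ∀ i, x i ∈ Icc (0 : ℝ) 1}

/-- `Y` is a cubical cut and project set: totally irrational (a field of `CPS`),
regular, aperiodic, and formed with the cubical window. -/
def IsCubicalCPSet : Prop := 𝒟.IsCubical ∧ 𝒟.Regular ∧ 𝒟.Aperiodic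

/-- `Y` is a canonical cut and project set. -/
def IsCanonicalCPSet : Prop := 𝒟.IsCanonical ∧ 𝒟.Regular ∧ 𝒟.Aperiodic

/-- For `y ∈ Y`, the (unique, by injectivity of `π` on `ℤ^k`) integer vector `ỹ`
with `ỹ + s ∈ S` and `π(ỹ + s) = y`. -/
def intRep (y : Fin k → ℝ) : Fin k → ℤ :=
  Classical.epsilon fun n : Fin k → ℤ =>
    intVec n + 𝒟.s ∈ 𝒟.strip ∧ 𝒟.proj (intVec n + 𝒟.s) = y

/-- The patch of shape `Ω` at `y`: `P(y,Ω) = {y' ∈ Y : ρ(ỹ' - ỹ) ∈ ρ(Ω)}`,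
where `Ω ⊆ ℝ^d` is viewed inside `⟨e₁,…,e_d⟩_ℝ ⊆ ℝ^k`. -/
def patch (Ω : Set (Fin d → ℝ)) (y : Fin k → ℝ) : Set (Fin k → ℝ) :=
  {y' | y' ∈ 𝒟.Y ∧
    𝒟.rho (intVec (𝒟.intRep y') - intVec (𝒟.intRep y)) ∈ 𝒟.rho '' (emb k d '' Ω)}

/-- Two patches of shape `Ω` are equivalent if they agree up to the translation
taking one distinguished point to the other. -/
def PatchEquiv (Ω : Set (Fin d → ℝ)) (y₁ y₂ : Fin k → ℝ) : Prop :=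
  𝒟.patch Ω y₁ = {z | ∃ w ∈ 𝒟.patch Ω y₂, z = w + (y₁ - y₂)}

/-- The pattern (equivalence class) of the patch of shape `Ω` at `y` occurs in the
region `R ⊆ E`: some point `y' ∈ Y ∩ R` has patch equivalent to that at `y`. -/
def OccursIn (Ω : Set (Fin d → ℝ)) (y : Fin k → ℝ) (R : Set (Fin k → ℝ)) : Prop :=
  ∃ y' ∈ 𝒟.Y ∩ R, 𝒟.PatchEquiv Ω y' y

/-- `Y` is linearly repetitive with respect to a collection `𝒜` of shapes in `ℝ^d`:
there is `C > 0` such that for every `Ω ∈ 𝒜`, every pattern of shape `Ω` occurring in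
`Y` occurs in every ball in `E` of volume `C·|Ω|` (balls in `E` being images under the
identification `ρ ∘ emb : ℝ^d ≅ E` of balls in `ℝ^d`). -/
def IsLR (𝒜 : Set (Set (Fin d → ℝ))) : Prop :=
  ∃ C > (0 : ℝ), ∀ Ω ∈ 𝒜, ∀ y ∈ 𝒟.Y, ∀ (x : Fin d → ℝ) (r : ℝ),
    volume (Metric.closedBall x r) = ENNReal.ofReal C * volume Ω →
    𝒟.OccursIn Ω y (𝒟.rho '' (emb k d '' Metric.closedBall x r))

/-- `Y` is `LR_Ω` with respect to a collection `𝒜` of shapes in `ℝ^d`: there is `C > 0`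
such that for every `Ω ∈ 𝒜`, every pattern of shape `Ω` occurring in `Y` occurs in every
translate of `C·Ω`. -/
def IsLROmega (𝒜 : Set (Set (Fin d → ℝ))) : Prop :=
  ∃ C > (0 : ℝ), ∀ Ω ∈ 𝒜, ∀ y ∈ 𝒟.Y, ∀ x : Fin d → ℝ,
    𝒟.OccursIn Ω y (𝒟.rho '' (emb k d '' {z | ∃ w ∈ Ω, z = x + C • w}))

end CPS

/-- `ℛ_d`: aligned rectangles in `ℝ^d` with integer vertices and nonempty interior. -/
def RdCollection (d : ℕ) : Set (Set (Fin d → ℝ)) :=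
  {Ω | ∃ a b : Fin d → ℤ, (∀ i, a i < b i) ∧
    Ω = {x : Fin d → ℝ | ∀ i, (a i : ℝ) ≤ x i ∧ x i ≤ (b i : ℝ)}}

/-- `𝒞_d`: convex polytopes in `ℝ^d` with vertices in `ℤ^d` and nonempty interior. -/
def CdCollection (d : ℕ) : Set (Set (Fin d → ℝ)) :=
  {Ω | (∃ V : Finset (Fin d → ℤ),
      Ω = convexHull ℝ ((fun n : Fin d → ℤ => intVec n) '' (V : Set (Fin d → ℤ)))) ∧
    (interior Ω).Nonempty}

open scoped Pointwise in
lemma exists_poly (d : ℕ) (u : Fin d → ℤ) (j0 : Fin d) (hu : u j0 ≠ 0) :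
    ∃ Ω ∈ CdCollection d, volume Ω = ENNReal.ofReal |(u j0 : ℝ)| ∧
      ∀ t : ℝ, 0 ≤ t → t ≤ 1 → t • intVec u ∈ Ω := by
  classical
  set cZ : Fin d → Fin d → ℤ := Function.update (fun j => Pi.single j 1) j0 u with hcZ
  set c : Fin d → Fin d → ℝ := fun j => intVec (cZ j) with hc
  have hvol : volume (parallelepiped c) = ENNReal.ofReal |(u j0 : ℝ)| := by
    have h1 := Measure.addHaar_parallelepiped (Pi.basisFun ℝ (Fin d)) c
    have h2 : (Pi.basisFun ℝ (Fin d)).addHaar = volume := by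
      rw [← addHaarMeasure_eq_volume_pi, Module.Basis.addHaar_def, Module.Basis.parallelepiped_basisFun]
    rw [h2] at h1
    rw [h1, Pi.basisFun_det_apply]
    have h3 : Matrix.of c = ((1 : Matrix (Fin d) (Fin d) ℝ).updateCol j0 (intVec u)).transpose := by
      ext i j
      simp only [hc, hcZ, Matrix.transpose_apply, Matrix.updateCol_apply, Matrix.of_apply, intVec,
        Function.update_apply]
      split_ifs with h
      · rfl
      · simp [Matrix.one_apply, Pi.single_apply]
    rw [h3, Matrix.det_transpose, ← Matrix.cramer_apply, Matrix.cramer_one]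
    simp [intVec]
  refine ⟨parallelepiped c, ⟨?_, ?_⟩, hvol, ?_⟩
  · have hfin : (∑ i, ({0, c i} : Set (Fin d → ℝ))).Finite :=
      Finset.sum_induction (fun i => ({0, c i} : Set (Fin d → ℝ))) Set.Finite
        (fun a b ha hb => ha.add hb) (by simp [← Set.singleton_zero]) (fun i _ => by simp)
    have hinj : Function.Injective (fun n : Fin d → ℤ => intVec n) := by
      intro a b hab
      ext i
      have := congrFun hab i
      simpa [intVec] using this
    refine ⟨(hfin.preimage (hinj.injOn)).toFinset, ?_⟩
    rw [parallelepiped_eq_convexHull]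
    congr 1
    rw [Set.Finite.coe_toFinset, Set.image_preimage_eq_of_subset]
    intro x hx
    rw [Set.mem_finsetSum] at hx
    obtain ⟨g, hg, rfl⟩ := hx
    have : ∀ i, ∃ n : Fin d → ℤ, g i = intVec n := by
      intro i
      rcases hg (i := i) (Finset.mem_univ i) with h | h
      · exact ⟨0, by rw [h]; ext; simp [intVec]⟩
      · exact ⟨cZ i, h⟩
    choose n hn using this
    refine ⟨∑ i, n i, ?_⟩
    ext j
    simp [hn, intVec]
  · by_contra hne
    rw [Set.not_nonempty_iff_eq_empty] at hne
    have hcv : Convex ℝ (parallelepiped c) := by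
      rw [parallelepiped_eq_convexHull]; exact convex_convexHull _ _
    have h0 := hcv.addHaar_frontier volume
    have : parallelepiped c ⊆ frontier (parallelepiped c) := by
      rw [frontier, hne, Set.sdiff_empty]; exact subset_closure
    have h1 := measure_mono_null this h0
    rw [hvol] at h1
    simp only [ENNReal.ofReal_eq_zero] at h1
    have : 0 < |(u j0 : ℝ)| := abs_pos.mpr (by exact_mod_cast hu)
    linarith
  · intro t h0 h1
    rw [mem_parallelepiped_iff]
    refine ⟨Pi.single j0 t, ⟨?_, ?_⟩, ?_⟩
    · intro i; by_cases h : i = j0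
      · subst h; simpa
      · simp [h]
    · intro i; by_cases h : i = j0
      · subst h; simpa
      · simp [h]
    · rw [Finset.sum_eq_single j0]
      · simp [hc, hcZ]
      · intro b _ hb; simp [hb]
      · simp

namespace CPS

variable {k d : ℕ} (𝒟 : CPS k d)

lemma intVec_add (m n : Fin k → ℤ) : intVec (m + n) = intVec m + intVec n := by
  ext; simp [intVec]

lemma intVec_sub (m n : Fin k → ℤ) : intVec (m - n) = intVec m - intVec n := by
  ext; simp [intVec]

lemma E_zero (hkd : d < k) (e : Fin k → ℝ) (he : e ∈ 𝒟.E) (h : ∀ i : Fin k, (i : ℕ) < d → e i = 0) :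
    e = 0 := by
  let f : 𝒟.E →ₗ[ℝ] (Fin d → ℝ) :=
    { toFun := fun x i => x.1 ⟨i, i.2.trans hkd⟩
      map_add' := fun x y => rfl
      map_smul' := fun c x => rfl }
  have hs : Function.Surjective f := by
    intro x
    refine ⟨⟨𝒟.rho (emb k d x), 𝒟.rho_mem _⟩, ?_⟩
    ext i
    have := 𝒟.rho_decomp (emb k d x) ⟨i, i.2.trans hkd⟩ i.2
    have h3 : emb k d x ⟨i, i.2.trans hkd⟩ = x i := by simp [emb]
    rw [h3] at this
    change 𝒟.rho (emb k d x) ⟨i, i.2.trans hkd⟩ = x i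
    linarith [this]
  have hi : Function.Injective f :=
    (LinearMap.injective_iff_surjective_of_finrank_eq_finrank
      (by rw [𝒟.rank_E]; simp)).2 hs
  have : (⟨e, he⟩ : 𝒟.E) = 0 := by
    apply hi
    ext i
    exact h _ i.2
  exact congrArg Subtype.val this

lemma rho_id (hkd : d < k) (e : Fin k → ℝ) (he : e ∈ 𝒟.E) : 𝒟.rho e = e := by
  have := 𝒟.E_zero hkd (e - 𝒟.rho e) (𝒟.E.sub_mem he (𝒟.rho_mem e)) (𝒟.rho_decomp e)
  exact (sub_eq_zero.mp this).symm

lemma rho_F (hkd : d < k) (x : Fin k → ℝ) (h : ∀ i : Fin k, (i : ℕ) < d → x i = 0) :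
    𝒟.rho x = 0 := by
  apply 𝒟.E_zero hkd _ (𝒟.rho_mem x)
  intro i hi
  have := 𝒟.rho_decomp x i hi
  rw [h i hi] at this
  linarith

lemma rho_congr (hkd : d < k) (x y : Fin k → ℝ) (h : ∀ i : Fin k, (i : ℕ) < d → x i = y i) :
    𝒟.rho x = 𝒟.rho y := by
  have := 𝒟.rho_F hkd (x - y) (fun i hi => by simp [h i hi])
  rw [map_sub] at this
  exact sub_eq_zero.mp this

lemma rhoStar_add (x y : Fin k → ℝ) : 𝒟.rhoStar (x + y) = 𝒟.rhoStar x + 𝒟.rhoStar y := by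
  simp only [rhoStar, map_add]; abel

lemma rhoStar_sub (x y : Fin k → ℝ) : 𝒟.rhoStar (x - y) = 𝒟.rhoStar x - 𝒟.rhoStar y := by
  simp only [rhoStar, map_sub]; abel

lemma mem_strip (hkd : d < k) (hc : 𝒟.IsCubical) (z : Fin k → ℝ) :
    z ∈ 𝒟.strip ↔ ∀ i : Fin k, d ≤ (i : ℕ) → 0 ≤ 𝒟.rhoStar z i ∧ 𝒟.rhoStar z i < 1 := by
  constructor
  · rintro ⟨w, hw, e, he, rfl⟩ i hi
    have h1 : 𝒟.rhoStar (w + e) = w := by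
      rw [rhoStar, map_add, 𝒟.rho_id hkd e he, 𝒟.rho_F hkd w (𝒟.window_sub w hw)]
      abel
    rw [h1]
    rw [hc] at hw
    have := hw i
    rwa [if_neg (by omega)] at this
  · intro h
    refine ⟨𝒟.rhoStar z, ?_, 𝒟.rho z, 𝒟.rho_mem z, by simp [rhoStar]⟩
    rw [hc]
    intro i
    split_ifs with hi
    · exact 𝒟.rho_decomp z i hi
    · exact h i (by omega)

/-- moving an integer point vertically into the strip -/
def adj (u : Fin k → ℤ) : Fin k → ℤ :=
  fun i => if (i : ℕ) < d then u i else u i - ⌊𝒟.rhoStar (intVec u + 𝒟.s) i⌋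

lemma rhoStar_adj (hkd : d < k) (u : Fin k → ℤ) (i : Fin k) (hi : d ≤ (i : ℕ)) :
    𝒟.rhoStar (intVec (𝒟.adj u) + 𝒟.s) i = Int.fract (𝒟.rhoStar (intVec u + 𝒟.s) i) := by
  have h : 𝒟.rho (intVec (𝒟.adj u) + 𝒟.s) = 𝒟.rho (intVec u + 𝒟.s) := by
    apply 𝒟.rho_congr hkd
    intro j hj
    simp [intVec, adj, hj]
  have h2 : ¬ ((i : ℕ) < d) := by omega
  unfold rhoStar at *
  rw [h]
  simp only [Pi.sub_apply, Pi.add_apply, intVec, adj, h2, if_false, rhoStar, Int.fract]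
  push_cast
  ring

lemma adj_mem (hkd : d < k) (hc : 𝒟.IsCubical) (u : Fin k → ℤ) :
    intVec (𝒟.adj u) + 𝒟.s ∈ 𝒟.strip := by
  rw [𝒟.mem_strip hkd hc]
  intro i hi
  rw [𝒟.rhoStar_adj hkd u i hi]
  exact ⟨Int.fract_nonneg _, Int.fract_lt_one _⟩

lemma intRep_eq (n : Fin k → ℤ) (hn : intVec n + 𝒟.s ∈ 𝒟.strip) :
    𝒟.intRep (𝒟.proj (intVec n + 𝒟.s)) = n := by
  have := Classical.epsilon_spec (p := fun m : Fin k → ℤ =>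
    intVec m + 𝒟.s ∈ 𝒟.strip ∧ 𝒟.proj (intVec m + 𝒟.s) = 𝒟.proj (intVec n + 𝒟.s)) ⟨n, hn, rfl⟩
  apply 𝒟.proj_inj
  have h : 𝒟.proj (intVec (𝒟.intRep (𝒟.proj (intVec n + 𝒟.s))) + 𝒟.s) =
    𝒟.proj (intVec n + 𝒟.s) := this.2
  have h1 := map_add 𝒟.proj (intVec (𝒟.intRep (𝒟.proj (intVec n + 𝒟.s)))) 𝒟.s
  have h2 := map_add 𝒟.proj (intVec n) 𝒟.s
  rw [h1] at h
  exact add_right_cancel (h.trans h2)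

lemma patch_key (hkd : d < k) (hc : 𝒟.IsCubical) (Ω : Set (Fin d → ℝ)) (n n' p : Fin k → ℤ)
    (hn : intVec n + 𝒟.s ∈ 𝒟.strip) (hn' : intVec n' + 𝒟.s ∈ 𝒟.strip)
    (hp : (fun i : Fin d => (p ⟨i, i.2.trans hkd⟩ : ℝ)) ∈ Ω)
    (he : 𝒟.PatchEquiv Ω (𝒟.proj (intVec n' + 𝒟.s)) (𝒟.proj (intVec n + 𝒟.s)))
    (i : Fin k) (hi : d ≤ (i : ℕ)) :
    0 ≤ Int.fract (𝒟.rhoStar (intVec n + 𝒟.s) i + 𝒟.rhoStar (intVec p) i)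
        + 𝒟.rhoStar (intVec n' + 𝒟.s) i - 𝒟.rhoStar (intVec n + 𝒟.s) i ∧
    Int.fract (𝒟.rhoStar (intVec n + 𝒟.s) i + 𝒟.rhoStar (intVec p) i)
        + 𝒟.rhoStar (intVec n' + 𝒟.s) i - 𝒟.rhoStar (intVec n + 𝒟.s) i < 1 := by
  set m := 𝒟.adj (n + p) with hm
  have hms := 𝒟.adj_mem hkd hc (n + p)
  rw [← hm] at hms
  have h1 : 𝒟.proj (intVec m + 𝒟.s) ∈ 𝒟.patch Ω (𝒟.proj (intVec n + 𝒟.s)) := by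
    refine ⟨⟨_, ⟨hms, m, rfl⟩, rfl⟩, ?_⟩
    rw [𝒟.intRep_eq m hms, 𝒟.intRep_eq n hn]
    refine ⟨_, ⟨_, hp, rfl⟩, ?_⟩
    apply 𝒟.rho_congr hkd
    intro j hj
    simp [emb, hj, intVec, hm, adj]
  have h2 : 𝒟.proj (intVec m + 𝒟.s) + (𝒟.proj (intVec n' + 𝒟.s) - 𝒟.proj (intVec n + 𝒟.s)) ∈
      𝒟.patch Ω (𝒟.proj (intVec n' + 𝒟.s)) := by
    rw [he]
    exact ⟨_, h1, rfl⟩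
  obtain ⟨⟨z, ⟨hz, m', rfl⟩, hzz⟩, -⟩ := h2
  have h3 : m' = m + (n' - n) := by
    apply 𝒟.proj_inj
    rw [← map_sub, ← map_add] at hzz
    have h4 : 𝒟.proj (intVec m' + 𝒟.s) = 𝒟.proj (intVec m') + 𝒟.proj 𝒟.s := map_add _ _ _
    have h5 : intVec m + 𝒟.s + (intVec n' + 𝒟.s - (intVec n + 𝒟.s)) =
        intVec (m + (n' - n)) + 𝒟.s := by
      rw [intVec_add, intVec_sub]; abel
    rw [h5, map_add, map_add] at hzz
    exact add_right_cancel hzz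
  have h6 := (𝒟.mem_strip hkd hc _).1 hz i hi
  have h7 : intVec m' + 𝒟.s = (intVec m + 𝒟.s) + ((intVec n' + 𝒟.s) - (intVec n + 𝒟.s)) := by
    rw [h3, intVec_add, intVec_sub]; abel
  rw [h7, rhoStar_add, rhoStar_sub] at h6
  have h8 := 𝒟.rhoStar_adj hkd (n + p) i hi
  rw [← hm] at h8
  have h9 : intVec (n + p) + 𝒟.s = (intVec n + 𝒟.s) + intVec p := by
    rw [intVec_add]; abel
  rw [h9, 𝒟.rhoStar_add (intVec n + 𝒟.s) (intVec p), Pi.add_apply] at h8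
  simp only [Pi.add_apply, Pi.sub_apply] at h6
  rw [h8] at h6
  constructor <;> linarith [h6.1, h6.2]

/-- density of the projected lattice -/
lemma dense_rhoStar (hkd : d < k) (τ : Fin k → ℝ) (ε : ℝ) (hε : 0 < ε) :
    ∃ n : Fin k → ℤ, ∀ i : Fin k, d ≤ (i : ℕ) → |𝒟.rhoStar (intVec n) i - τ i| < ε := by
  set τ' : Fin k → ℝ := fun i => if (i : ℕ) < d then 0 else τ i with hτ'
  have hcont : Continuous 𝒟.rhoStar := by
    unfold rhoStar
    exact continuous_id.sub 𝒟.rho.continuous_of_finiteDimensional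
  have hopen : IsOpen (𝒟.rhoStar ⁻¹' Metric.ball τ' ε) := Metric.isOpen_ball.preimage hcont
  have hst : 𝒟.rhoStar τ' = τ' := by
    rw [rhoStar, 𝒟.rho_F hkd τ' (fun i hi => by simp [hτ', hi]), sub_zero]
  obtain ⟨z, hz, e, he, n, rfl⟩ := 𝒟.totallyIrrational.inter_open_nonempty _ hopen
    ⟨τ', by simp [hst, hε]⟩
  refine ⟨n, fun i hi => ?_⟩
  have h0 : 𝒟.rhoStar e = 0 := by rw [rhoStar, 𝒟.rho_id hkd e he, sub_self]
  rw [Set.mem_preimage, rhoStar_add, h0, zero_add, Metric.mem_ball, dist_pi_lt_iff hε] at hz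
  have := hz i
  rw [Real.dist_eq] at this
  simpa [hτ', show ¬ ((i : ℕ) < d) by omega] using this

lemma periodic_zero (ha : 𝒟.Aperiodic) (n : Fin k → ℤ)
    (hn : intVec n ∈ 𝒟.E) : n = 0 := by
  have hstrip : ∀ z e, z ∈ 𝒟.strip → e ∈ 𝒟.E → z + e ∈ 𝒟.strip := by
    rintro _ e ⟨w, hw, e', he', rfl⟩ he
    exact ⟨w, hw, e' + e, 𝒟.E.add_mem he' he, by abel⟩
  have hY : ∀ m : Fin k → ℤ, intVec m ∈ 𝒟.E → ∀ y ∈ 𝒟.Y, y + intVec m ∈ 𝒟.Y := by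
    rintro m hm _ ⟨_, ⟨hz, l, rfl⟩, rfl⟩
    refine ⟨intVec l + 𝒟.s + intVec m, ⟨hstrip _ _ hz hm, l + m, ?_⟩, ?_⟩
    · rw [intVec_add]; abel
    · rw [map_add, 𝒟.proj_id _ hm]
  have hneg : intVec (-n) = - intVec n := by ext; simp [intVec]
  have h0 : intVec n = 0 := by
    apply ha _ hn
    apply Set.Subset.antisymm
    · rintro _ ⟨y, hy, rfl⟩
      exact hY n hn y hy
    · intro y hy
      refine ⟨y + intVec (-n), hY _ (by rw [hneg]; exact 𝒟.E.neg_mem hn) y hy, ?_⟩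
      rw [hneg]; abel
  ext i
  have := congrFun h0 i
  simpa [intVec] using this


lemma exists_pattern (hkd : d < k) (hc : 𝒟.IsCubical) (Ω : Set (Fin d → ℝ))
    (J : Finset (Fin k)) (hJ : ∀ j ∈ J, d ≤ (j : ℕ)) (p : Fin k → Fin k → ℤ)
    (hp : ∀ j ∈ J, (fun i : Fin d => (p j ⟨i, i.2.trans hkd⟩ : ℝ)) ∈ Ω)
    (ε : ℝ) (hε : ε ≤ 1)
    (h0 : ∀ j ∈ J, 0 < |𝒟.rhoStar (intVec (p j)) j|)
    (h1 : ∀ j ∈ J, |𝒟.rhoStar (intVec (p j)) j| < ε) :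
    ∃ n : Fin k → ℤ, intVec n + 𝒟.s ∈ 𝒟.strip ∧ ∀ n' : Fin k → ℤ, intVec n' + 𝒟.s ∈ 𝒟.strip →
      𝒟.PatchEquiv Ω (𝒟.proj (intVec n' + 𝒟.s)) (𝒟.proj (intVec n + 𝒟.s)) →
      ∀ j ∈ J, ∃ z : ℤ, |𝒟.rhoStar (intVec n' + 𝒟.s) j - z| < ε := by
  set c : Fin k → ℝ := fun j => 𝒟.rhoStar (intVec (p j)) j with hcdef
  obtain ⟨δ, hδ, hδJ⟩ : ∃ δ > 0, ∀ j ∈ J, δ ≤ |c j| / 2 := by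
    rcases J.eq_empty_or_nonempty with rfl | hne
    · exact ⟨1, one_pos, by simp⟩
    · obtain ⟨j, hj, hmin⟩ := J.exists_min_image (fun j => |c j| / 2) hne
      exact ⟨|c j| / 2, by have := h0 j hj; simp only [hcdef]; linarith, hmin⟩
  obtain ⟨n0, hn0⟩ := 𝒟.dense_rhoStar hkd
    (fun i => (if 0 < c i then 1 - c i / 2 else - c i / 2) - 𝒟.rhoStar 𝒟.s i) δ hδ
  refine ⟨𝒟.adj n0, 𝒟.adj_mem hkd hc n0, ?_⟩
  intro n' hn' heq j hj
  have hjd := hJ j hj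
  have hkey := 𝒟.patch_key hkd hc Ω _ n' (p j) (𝒟.adj_mem hkd hc n0) hn' (hp j hj) heq j hjd
  have hw' := (𝒟.mem_strip hkd hc _).1 hn' j hjd
  rw [𝒟.rhoStar_adj hkd n0 j hjd] at hkey
  have hn := hn0 j hjd
  have hadd : 𝒟.rhoStar (intVec n0 + 𝒟.s) j = 𝒟.rhoStar (intVec n0) j + 𝒟.rhoStar 𝒟.s j := by
    rw [rhoStar_add]; rfl
  have hδj := hδJ j hj
  have hc0 := h0 j hj
  have hc1 := h1 j hj
  change 0 < |c j| at hc0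
  change |c j| < ε at hc1
  change 0 ≤ Int.fract (_ + c j) + _ - _ ∧ Int.fract (_ + c j) + _ - _ < 1 at hkey
  set w := 𝒟.rhoStar (intVec n0 + 𝒟.s) j with hw
  set w' := 𝒟.rhoStar (intVec n' + 𝒟.s) j with hw'def
  rw [abs_lt] at hn
  by_cases hpos : 0 < c j
  · simp only [hpos, if_true] at hn
    rw [abs_of_pos hpos] at hδj hc0 hc1
    have hf : Int.fract w = w := Int.fract_eq_self.2 ⟨by linarith, by linarith⟩
    rw [hf] at hkey
    have hf2 : Int.fract (w + c j) = w + c j - 1 := by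
      rw [Int.fract_eq_iff]
      exact ⟨by linarith, by linarith, 1, by push_cast; ring⟩
    rw [hf2] at hkey
    refine ⟨1, ?_⟩
    rw [abs_lt]; push_cast
    constructor <;> linarith [hkey.1, hkey.2, hw'.1, hw'.2]
  · simp only [hpos, if_false] at hn
    have hneg : |c j| = - c j := abs_of_nonpos (not_lt.1 hpos)
    rw [hneg] at hδj hc0 hc1
    have hf : Int.fract w = w := Int.fract_eq_self.2 ⟨by linarith, by linarith⟩
    rw [hf] at hkey
    have hf2 : Int.fract (w + c j) = w + c j + 1 := by
      rw [Int.fract_eq_iff]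
      exact ⟨by linarith, by linarith, -1, by push_cast; ring⟩
    rw [hf2] at hkey
    refine ⟨0, ?_⟩
    rw [abs_lt]; push_cast
    constructor <;> linarith [hkey.1, hkey.2, hw'.1, hw'.2]

lemma grid_bound (hkd : d < k) (J : Finset (Fin k)) (hJ : ∀ j ∈ J, d ≤ (j : ℕ))
    (K : ℕ) (hK : 0 < K) (R : ℝ) (hR : 0 ≤ R)
    (H : ∀ θ : J → Fin K, ∃ m : Fin k → ℤ, (∀ i : Fin k, (i : ℕ) < d → |(m i : ℝ) + 𝒟.s i| ≤ R) ∧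
      ∀ j : J, ∃ z : ℤ, |𝒟.rhoStar (intVec m + 𝒟.s) j - (θ j : ℕ) / (K : ℝ) - z| < 1 / (2 * K)) :
    (K : ℝ) ^ J.card ≤ (2 * R + 1) ^ d := by
  classical
  choose m hm hmz using H
  have hK' : (0 : ℝ) < K := by exact_mod_cast hK
  let B : Finset (Fin d → ℤ) := Fintype.piFinset fun i : Fin d =>
    Finset.Icc ⌈- 𝒟.s ⟨i, i.2.trans hkd⟩ - R⌉ ⌊R - 𝒟.s ⟨i, i.2.trans hkd⟩⌋
  let f : (J → Fin K) → (Fin d → ℤ) := fun θ i => m θ ⟨i, i.2.trans hkd⟩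
  have hfB : ∀ θ ∈ (Finset.univ : Finset (J → Fin K)), f θ ∈ B := by
    intro θ _
    rw [Fintype.mem_piFinset]
    intro i
    have := abs_le.1 (hm θ ⟨i, i.2.trans hkd⟩ i.2)
    rw [Finset.mem_Icc, Int.ceil_le, Int.le_floor]
    constructor <;> simp only [f] <;> linarith [this.1, this.2]
  have hinj : Set.InjOn f (Finset.univ : Finset (J → Fin K)) := by
    intro θ _ θ' _ hff
    ext j
    have hjd := hJ j j.2
    have hrho : 𝒟.rho (intVec (m θ) + 𝒟.s) = 𝒟.rho (intVec (m θ') + 𝒟.s) := by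
      apply 𝒟.rho_congr hkd
      intro i hi
      have := congrFun hff ⟨i, hi⟩
      simp only [f] at this
      simp [intVec, this]
    obtain ⟨z, hz⟩ := hmz θ j
    obtain ⟨z', hz'⟩ := hmz θ' j
    simp only [rhoStar, hrho, Pi.sub_apply, Pi.add_apply, intVec] at hz hz'
    set a : ℝ := 𝒟.s j - 𝒟.rho (intVec (m θ') + 𝒟.s) j with ha
    have e1 : |(((θ' j : ℕ) : ℝ) - (θ j : ℕ)) / K + ((m θ j - m θ' j - z + z' : ℤ) : ℝ)| < 1 / K := by
      have h1 := abs_lt.1 hz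
      have h2 := abs_lt.1 hz'
      have h3 : (1 : ℝ) / K = 1 / (2 * K) + 1 / (2 * K) := by field_simp; norm_num
      rw [h3, abs_lt, sub_div]
      push_cast
      constructor <;> linarith [h1.1, h1.2, h2.1, h2.2]
    set q : ℤ := m θ j - m θ' j - z + z' with hq
    have e2 : |(((θ' j : ℕ) : ℤ) - (θ j : ℕ) + q * K : ℤ)| < 1 := by
      have h4 : (((θ' j : ℕ) : ℝ) - (θ j : ℕ)) / K + (q : ℝ) =
          ((((θ' j : ℕ) : ℤ) - (θ j : ℕ) + q * K : ℤ) : ℝ) / K := by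
        push_cast; field_simp
      rw [h4, abs_div, abs_of_pos hK', div_lt_div_iff_of_pos_right hK'] at e1
      exact_mod_cast e1
    rw [Int.abs_lt_one_iff] at e2
    have b1 : ((θ j : ℕ) : ℤ) < K := by exact_mod_cast (θ j).2
    have b2 : ((θ' j : ℕ) : ℤ) < K := by exact_mod_cast (θ' j).2
    have b3 : (0 : ℤ) ≤ (θ j : ℕ) := by positivity
    have b4 : (0 : ℤ) ≤ (θ' j : ℕ) := by positivity
    have hq0 : q = 0 := by
      by_contra hne
      rcases lt_or_gt_of_ne hne with h | h
      · have : q * K ≤ -1 * K := by apply mul_le_mul_of_nonneg_right <;> omega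
        omega
      · have : 1 * (K : ℤ) ≤ q * K := by apply mul_le_mul_of_nonneg_right <;> omega
        omega
    rw [hq0] at e2
    omega
  have hcard := Finset.card_le_card_of_injOn f hfB hinj
  rw [Finset.card_univ, Fintype.card_fun, Fintype.card_fin, Fintype.card_coe,
    Fintype.card_piFinset] at hcard
  calc (K : ℝ) ^ J.card ≤ ((∏ i : Fin d, (Finset.Icc ⌈- 𝒟.s ⟨i, i.2.trans hkd⟩ - R⌉
          ⌊R - 𝒟.s ⟨i, i.2.trans hkd⟩⌋).card : ℕ) : ℝ) := by exact_mod_cast hcard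
    _ ≤ ∏ i : Fin d, (2 * R + 1) := by
        push_cast
        apply Finset.prod_le_prod
        · intros; positivity
        · intro i _
          rw [Int.card_Icc]
          set a := 𝒟.s ⟨i, i.2.trans hkd⟩
          have h1 := Int.le_ceil (- a - R)
          have h2 := Int.floor_le (R - a)
          have : (((⌊R - a⌋ + 1 - ⌈-a - R⌉).toNat : ℤ) : ℝ) = ((max (⌊R - a⌋ + 1 - ⌈-a - R⌉) 0 : ℤ) : ℝ) := by
            rw [Int.toNat_eq_max]
          rw [Int.cast_natCast] at this
          rw [this]
          push_cast
          apply max_le <;> linarith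
    _ = (2 * R + 1) ^ d := by simp

lemma main_bound (hd : 1 ≤ d) (hkd : d < k) (hc : 𝒟.IsCubical) (hLR : 𝒟.IsLR (CdCollection d)) :
    ∃ A B : ℝ, 0 ≤ A ∧ 0 ≤ B ∧ ∀ Ω ∈ CdCollection d, ∀ V : ℝ, 0 ≤ V → volume Ω = ENNReal.ofReal V →
      ∀ (J : Finset (Fin k)), (∀ j ∈ J, d ≤ (j : ℕ)) → ∀ (p : Fin k → Fin k → ℤ),
      (∀ j ∈ J, (fun i : Fin d => (p j ⟨i, i.2.trans hkd⟩ : ℝ)) ∈ Ω) →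
      ∀ K : ℕ, 0 < K → (∀ j ∈ J, 0 < |𝒟.rhoStar (intVec (p j)) j|) →
      (∀ j ∈ J, |𝒟.rhoStar (intVec (p j)) j| < 1 / (4 * K)) →
      (K : ℝ) ^ J.card ≤ A * V + B := by
  obtain ⟨C, hC, hLR⟩ := hLR
  set P := LinearMap.toContinuousLinearMap 𝒟.proj with hP
  set R0 := ‖P‖ with hR0
  have hR0n : 0 ≤ R0 := norm_nonneg _
  refine ⟨2 ^ (d - 1) * C, 2 ^ (d - 1) * (2 * R0 + 1) ^ d, by positivity, by positivity, ?_⟩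
  intro Ω hΩ V hV hvol J hJ p hp K hK h0 h1
  have hK' : (1 : ℝ) ≤ K := by exact_mod_cast hK
  obtain ⟨n, hn, hpat⟩ := 𝒟.exists_pattern hkd hc Ω J hJ p hp (1 / (4 * K))
    (by rw [div_le_one (by positivity)]; linarith) h0 h1
  set r : ℝ := (C * V) ^ ((1 : ℝ) / d) / 2 with hr
  have hCV : 0 ≤ C * V := by positivity
  have hrn : 0 ≤ r := by positivity
  have hrd : (2 * r) ^ d = C * V := by
    rw [hr, mul_div_cancel₀ _ (two_ne_zero), one_div]
    exact Real.rpow_inv_natCast_pow hCV (by omega)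
  have hgrid := 𝒟.grid_bound hkd J hJ K hK (r + R0) (by positivity) (by
    intro θ
    obtain ⟨t, ht⟩ := 𝒟.dense_rhoStar hkd
      (fun i => if h : i ∈ J then ((θ ⟨i, h⟩ : ℕ) : ℝ) / K else 0) (1 / (4 * K)) (by positivity)
    obtain ⟨y', ⟨⟨_, ⟨hz, n', rfl⟩, rfl⟩, hy'⟩, heq⟩ := hLR Ω hΩ (𝒟.proj (intVec n + 𝒟.s))
      ⟨_, ⟨hn, n, rfl⟩, rfl⟩ (fun i : Fin d => -(t ⟨i, i.2.trans hkd⟩ : ℝ)) r (by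
        rw [Real.volume_pi_closedBall _ hrn, Fintype.card_fin, hrd, hvol,
          ENNReal.ofReal_mul hC.le])
    obtain ⟨_, ⟨b, hb, rfl⟩, hbb⟩ := hy'
    refine ⟨n' + t, ?_, ?_⟩
    · intro i hi
      rw [Metric.mem_closedBall, dist_pi_le_iff hrn] at hb
      have hbi := hb ⟨i, hi⟩
      rw [Real.dist_eq] at hbi
      have e1 : b ⟨i, hi⟩ = 𝒟.rho (emb k d b) i := by
        have := 𝒟.rho_decomp (emb k d b) i hi
        have h3 : emb k d b i = b ⟨i, hi⟩ := by simp [emb, hi]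
        rw [h3] at this
        linarith
      have e2 : 𝒟.proj (intVec n' + 𝒟.s) = 𝒟.rho (intVec n' + 𝒟.s)
          + P (𝒟.rhoStar (intVec n' + 𝒟.s)) := by
        have : P (𝒟.rhoStar (intVec n' + 𝒟.s)) = 𝒟.proj (𝒟.rhoStar (intVec n' + 𝒟.s)) := rfl
        rw [this, rhoStar, map_sub, 𝒟.proj_id _ (𝒟.rho_mem _)]
        abel
      have e3 : ‖P (𝒟.rhoStar (intVec n' + 𝒟.s))‖ ≤ R0 := by
        have hw : ‖𝒟.rhoStar (intVec n' + 𝒟.s)‖ ≤ 1 := by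
          rw [pi_norm_le_iff_of_nonneg zero_le_one]
          intro l
          rw [Real.norm_eq_abs]
          by_cases hl : (l : ℕ) < d
          · have h5 : 𝒟.rhoStar (intVec n' + 𝒟.s) l = 0 := 𝒟.rho_decomp _ l hl
            rw [h5]; simp
          · have h5 := (𝒟.mem_strip hkd hc _).1 hz l (by omega)
            rw [abs_of_nonneg h5.1]; exact h5.2.le
        calc _ ≤ ‖P‖ * ‖𝒟.rhoStar (intVec n' + 𝒟.s)‖ := P.le_opNorm _
          _ ≤ ‖P‖ * 1 := by gcongr
          _ = R0 := by rw [mul_one]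
      have e4 := (norm_le_pi_norm _ i).trans e3
      rw [Real.norm_eq_abs] at e4
      have e5 := 𝒟.rho_decomp (intVec n' + 𝒟.s) i hi
      have e6 := congrFun (hbb.trans e2) i
      rw [← e1, Pi.add_apply] at e6
      have e7 : (intVec n' + 𝒟.s) i = (n' i : ℝ) + 𝒟.s i := rfl
      rw [e7] at e5
      have e8 := abs_le.1 hbi
      have e9 := abs_le.1 e4
      rw [abs_le]
      simp only [Pi.add_apply]
      push_cast
      constructor <;> linarith [e8.1, e8.2, e9.1, e9.2]
    · intro j
      obtain ⟨z, hzz⟩ := hpat n' hz heq j j.2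
      refine ⟨z, ?_⟩
      have ht' := ht j (hJ j j.2)
      simp only [j.2, dif_pos] at ht'
      have e1 : 𝒟.rhoStar (intVec (n' + t) + 𝒟.s) j =
          𝒟.rhoStar (intVec n' + 𝒟.s) j + 𝒟.rhoStar (intVec t) j := by
        have : intVec (n' + t) + 𝒟.s = (intVec n' + 𝒟.s) + intVec t := by
          rw [intVec_add]; abel
        rw [this, 𝒟.rhoStar_add (intVec n' + 𝒟.s)]; rfl
      rw [e1]
      have h3 : (1 : ℝ) / (2 * K) = 1 / (4 * K) + 1 / (4 * K) := by field_simp; norm_num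
      have a1 := abs_lt.1 hzz
      have a2 := abs_lt.1 ht'
      rw [h3, abs_lt]
      constructor <;> linarith [a1.1, a1.2, a2.1, a2.2])
  calc (K : ℝ) ^ J.card ≤ (2 * (r + R0) + 1) ^ d := hgrid
    _ = (2 * r + (2 * R0 + 1)) ^ d := by ring
    _ ≤ 2 ^ (d - 1) * ((2 * r) ^ d + (2 * R0 + 1) ^ d) :=
        add_pow_le (by positivity) (by positivity) d
    _ = _ := by rw [hrd]; ring

/-- the linear forms defining `E` as a graph -/
def form (i : Fin k) : (Fin d → ℝ) →ₗ[ℝ] ℝ where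
  toFun x := 𝒟.rho (emb k d x) i
  map_add' x y := by
    have : emb k d (x + y) = emb k d x + emb k d y := by
      ext j; simp only [emb, Pi.add_apply]; split_ifs <;> simp
    rw [this, map_add]; rfl
  map_smul' c x := by
    have : emb k d (c • x) = c • emb k d x := by
      ext j; simp only [emb, Pi.smul_apply]; split_ifs <;> simp
    rw [this, map_smul]; rfl

lemma rhoStar_eq_form (hkd : d < k) (n : Fin k → ℤ) (i : Fin k) :
    𝒟.rhoStar (intVec n) i = n i - 𝒟.form i (fun j : Fin d => (n ⟨j, j.2.trans hkd⟩ : ℝ)) := by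
  have : 𝒟.rho (intVec n) = 𝒟.rho (emb k d (fun j : Fin d => (n ⟨j, j.2.trans hkd⟩ : ℝ))) := by
    apply 𝒟.rho_congr hkd
    intro j hj
    simp [emb, hj, intVec]
  rw [rhoStar, this]; rfl

lemma exists_irrational (hkd : d < k) (i : Fin k) (hi : d ≤ (i : ℕ)) :
    ∃ j : Fin d, Irrational (𝒟.form i (Pi.single j 1)) := by
  by_contra hcon
  push Not at hcon
  have h1 : ∀ j : Fin d, ∃ q : ℚ, (q : ℝ) = 𝒟.form i (Pi.single j 1) := by
    intro j
    have := hcon j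
    simpa [Irrational] using this
  choose q hq using h1
  set D : ℕ := ∏ j, (q j).den with hD
  have hDpos : 0 < D := Finset.prod_pos fun j _ => (q j).den_pos
  have h2 : ∀ j : Fin d, ∃ z : ℤ, (D : ℝ) * q j = z := by
    intro j
    obtain ⟨e, he⟩ : (q j).den ∣ D := Finset.dvd_prod_of_mem _ (Finset.mem_univ j)
    refine ⟨e * (q j).num, ?_⟩
    have h3 : ((q j : ℚ) : ℝ) * (q j).den = (q j).num := by exact_mod_cast Rat.mul_den_eq_num (q j)
    rw [he]; push_cast
    linear_combination (e : ℝ) * h3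
  choose z hz using h2
  have h4 : ∀ n : Fin k → ℤ, ∃ y : ℤ, (D : ℝ) * 𝒟.rhoStar (intVec n) i = y := by
    intro n
    refine ⟨D * n i - ∑ j : Fin d, n ⟨j, j.2.trans hkd⟩ * z j, ?_⟩
    rw [𝒟.rhoStar_eq_form hkd, LinearMap.pi_apply_eq_sum_univ]
    push_cast
    rw [mul_sub, Finset.mul_sum]
    congr 1
    apply Finset.sum_congr rfl
    intro j _
    have : (fun j_1 : Fin d => if j = j_1 then (1 : ℝ) else 0) = Pi.single j 1 := by
      ext l; simp [Pi.single_apply, eq_comm]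
    rw [this, ← hq j, ← hz j, smul_eq_mul]
    ring
  have hD' : (0 : ℝ) < D := by exact_mod_cast hDpos
  obtain ⟨n, hn⟩ := 𝒟.dense_rhoStar hkd (fun _ => 1 / (2 * D)) (1 / (2 * D)) (by positivity)
  obtain ⟨y, hy⟩ := h4 n
  have h5 := abs_lt.1 (hn i hi)
  have h6 : 0 < 𝒟.rhoStar (intVec n) i := by linarith [h5.1]
  have h7 : 𝒟.rhoStar (intVec n) i < 1 / D := by
    have : (1 : ℝ) / D = 1 / (2 * D) + 1 / (2 * D) := by field_simp; norm_num
    linarith [h5.2]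
  have h8 : (0 : ℝ) < y := by rw [← hy]; positivity
  have h9 : (y : ℝ) < 1 := by
    rw [← hy]
    calc _ < (D : ℝ) * (1 / D) := by gcongr
      _ = 1 := by field_simp
  have : (0 : ℤ) < y := by exact_mod_cast h8
  have : y < (1 : ℤ) := by exact_mod_cast h9
  omega

/-- extension of an integer vector in the first `d` coordinates -/
def extv (u : Fin d → ℤ) (a : ℤ) : Fin k → ℤ := fun i => if h : (i : ℕ) < d then u ⟨i, h⟩ else a

lemma extv_first (hkd : d < k) (u : Fin d → ℤ) (a : ℤ) :
    (fun i : Fin d => ((extv u a : Fin k → ℤ) ⟨i, i.2.trans hkd⟩ : ℝ)) = intVec u := by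
  ext i; simp [extv, intVec]

lemma rhoStar_extv (hkd : d < k) (u : Fin d → ℤ) (a : ℤ) (i : Fin k) (hi : d ≤ (i : ℕ)) :
    𝒟.rhoStar (intVec (extv u a)) i = a - 𝒟.form i (intVec u) := by
  rw [𝒟.rhoStar_eq_form hkd, extv_first hkd]
  simp [extv, show ¬ ((i : ℕ) < d) by omega]

lemma intVec_single (j : Fin d) : intVec (Pi.single j 1) = (Pi.single j 1 : Fin d → ℝ) := by
  ext l; by_cases h : l = j
  · subst h; simp [intVec]
  · simp [intVec, h]

lemma exists_common (hkd : d < k) (i i' : Fin k) (hi : d ≤ (i : ℕ)) (hi' : d ≤ (i' : ℕ)) :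
    ∃ v : Fin d → ℤ, Irrational (𝒟.form i (intVec v)) ∧ Irrational (𝒟.form i' (intVec v)) := by
  obtain ⟨j, hj⟩ := 𝒟.exists_irrational hkd i hi
  obtain ⟨j', hj'⟩ := 𝒟.exists_irrational hkd i' hi'
  by_cases h1 : Irrational (𝒟.form i' (Pi.single j 1))
  · exact ⟨Pi.single j 1, by rwa [intVec_single], by rwa [intVec_single]⟩
  by_cases h2 : Irrational (𝒟.form i (Pi.single j' 1))
  · exact ⟨Pi.single j' 1, by rwa [intVec_single], by rwa [intVec_single]⟩
  refine ⟨Pi.single j 1 + Pi.single j' 1, ?_, ?_⟩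
  · rw [intVec_add, map_add, intVec_single, intVec_single]
    obtain ⟨q, hq⟩ : ∃ q : ℚ, (q : ℝ) = 𝒟.form i (Pi.single j' 1) := by simpa [Irrational] using h2
    rw [← hq]; exact hj.add_ratCast q
  · rw [intVec_add, map_add, intVec_single, intVec_single]
    obtain ⟨q, hq⟩ : ∃ q : ℚ, (q : ℝ) = 𝒟.form i' (Pi.single j 1) := by simpa [Irrational] using h1
    rw [← hq]; exact hj'.ratCast_add q

lemma caseA (hd : 1 ≤ d) (hkd : d + 2 ≤ k) (hc : 𝒟.IsCubical) : ¬ 𝒟.IsLR (CdCollection d) := by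
  intro hLR
  have hkd' : d < k := by omega
  obtain ⟨A, B, hA, hB, H⟩ := 𝒟.main_bound hd hkd' hc hLR
  set i1 : Fin k := ⟨d, by omega⟩ with hi1
  set i2 : Fin k := ⟨d + 1, by omega⟩ with hi2
  have hne : i1 ≠ i2 := by simp [hi1, hi2]
  obtain ⟨v, hv1, hv2⟩ := 𝒟.exists_common hkd' i1 i2 (by simp [hi1]) (by simp [hi2])
  obtain ⟨j0, hj0⟩ : ∃ j0, v j0 ≠ 0 := by
    by_contra hcon
    push Not at hcon
    have : intVec v = 0 := by ext l; simp [intVec, hcon l]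
    rw [this, map_zero] at hv1
    exact not_irrational_zero hv1
  have key : ∀ K : ℕ, 0 < K → (K : ℝ) ^ 2 ≤ A * (4 * K * |(v j0 : ℝ)|) + B := by
    intro K hK
    have hK' : (0 : ℝ) < K := by exact_mod_cast hK
    obtain ⟨Ω, hΩ, hvol, hmem⟩ := exists_poly d ((4 * K : ℤ) • v) j0 (by
      simp [hj0]; omega)
    have hJ : ∀ j ∈ ({i1, i2} : Finset (Fin k)), d ≤ (j : ℕ) := by
      intro j hj
      simp only [Finset.mem_insert, Finset.mem_singleton] at hj
      rcases hj with rfl | rfl <;> simp [hi1, hi2]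
    have hirr : ∀ j ∈ ({i1, i2} : Finset (Fin k)), Irrational (𝒟.form j (intVec v)) := by
      intro j hj
      simp only [Finset.mem_insert, Finset.mem_singleton] at hj
      rcases hj with rfl | rfl <;> assumption
    have hdir := fun j : Fin k => Real.exists_int_int_abs_mul_sub_le (𝒟.form j (intVec v))
      (n := 4 * K) (by omega)
    choose a q hq0 hq1 hq2 using hdir
    have hform : ∀ j ∈ ({i1, i2} : Finset (Fin k)),
        𝒟.rhoStar (intVec (extv (q j • v) (a j))) j = -(q j * 𝒟.form j (intVec v) - a j) := by
      intro j hj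
      rw [𝒟.rhoStar_extv hkd' _ _ j (hJ j hj)]
      have : intVec (q j • v) = (q j : ℝ) • intVec v := by ext l; simp [intVec]
      rw [this, map_smul, smul_eq_mul]; ring
    have := H Ω hΩ (4 * K * |(v j0 : ℝ)|) (by positivity) (by
        rw [hvol]
        congr 1
        simp [abs_mul]) {i1, i2} hJ (fun j => extv (q j • v) (a j)) (by
        intro j hj
        rw [extv_first hkd']
        have h3 := hmem ((q j : ℝ) / (4 * K))
          (div_nonneg (by exact_mod_cast (hq0 j).le) (by positivity))
          (by rw [div_le_one (by positivity)]; exact_mod_cast hq1 j)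
        convert h3 using 1
        ext l
        simp [intVec]
        field_simp) K hK (by
        intro j hj
        rw [hform j hj, abs_neg, abs_pos]
        have h4 : Irrational (q j * 𝒟.form j (intVec v) - a j) :=
          ((hirr j hj).intCast_mul (hq0 j).ne').sub_intCast _
        exact h4.ne_zero) (by
        intro j hj
        rw [hform j hj, abs_neg]
        refine (hq2 j).trans_lt ?_
        push_cast
        apply one_div_lt_one_div_of_lt <;> linarith)
    rwa [Finset.card_pair hne] at this
  set c := A * (4 * |(v j0 : ℝ)|) with hcc
  have hcn : 0 ≤ c := by positivity
  obtain ⟨K, hK⟩ := exists_nat_gt (c + B + 1)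
  have h1 : (1 : ℝ) ≤ K := by linarith
  have h2 := key K (by have : (0 : ℝ) < K := by linarith
                       exact_mod_cast this)
  have h3 : A * (4 * K * |(v j0 : ℝ)|) = c * K := by rw [hcc]; ring
  rw [h3] at h2
  nlinarith

lemma caseB (hd : 2 ≤ d) (hkd : k = d + 1) (hc : 𝒟.IsCubical) (ha : 𝒟.Aperiodic) :
    ¬ 𝒟.IsLR (CdCollection d) := by
  intro hLR
  have hkd' : d < k := by omega
  obtain ⟨A, B, hA, hB, H⟩ := 𝒟.main_bound (by omega) hkd' hc hLR
  set i : Fin k := ⟨d, by omega⟩ with hi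
  have hid : d ≤ (i : ℕ) := by simp [hi]
  obtain ⟨j, hj⟩ := 𝒟.exists_irrational hkd' i hid
  obtain ⟨j', hjj⟩ : ∃ j' : Fin d, j' ≠ j := by
    haveI : Nontrivial (Fin d) := Fin.nontrivial_iff_two_le.2 hd
    exact exists_ne j
  have key : ∀ K : ℕ, 0 < K → (K : ℝ) ≤ A + B := by
    intro K hK
    have hK' : (0 : ℝ) < K := by exact_mod_cast hK
    have hdense := dense_addSubgroupClosure_pair_iff.2
      (show Irrational (𝒟.form i (Pi.single j 1) / 1) by rwa [div_one])
    obtain ⟨x, hx, hx'⟩ := Metric.dense_iff.1 hdense (- 𝒟.form i (Pi.single j' 1)) (1 / (4 * K))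
      (by positivity)
    obtain ⟨m, n, rfl⟩ := AddSubgroup.mem_closure_pair.1 hx'
    rw [Metric.mem_ball, Real.dist_eq] at hx
    set u : Fin d → ℤ := m • Pi.single j 1 + Pi.single j' 1 with hu
    have huj : u j' = 1 := by simp [hu, hjj]
    obtain ⟨Ω, hΩ, hvol, hmem⟩ := exists_poly d u j' (by simp [huj])
    have hform : 𝒟.rhoStar (intVec (extv u (-n))) i =
        -(m • 𝒟.form i (Pi.single j 1) + n • (1 : ℝ) - -𝒟.form i (Pi.single j' 1)) := by
      rw [𝒟.rhoStar_extv hkd' _ _ i hid]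
      have h1 : intVec (m • (Pi.single j 1 : Fin d → ℤ)) = (m : ℝ) • intVec (Pi.single j 1) := by
        ext l; simp [intVec]
      rw [hu, intVec_add, h1, map_add, map_smul, intVec_single, intVec_single]
      simp
      ring
    have := H Ω hΩ 1 zero_le_one (by rw [hvol, huj]; simp) {i} (by simpa using hid)
      (fun _ => extv u (-n)) (by
        intro _ _
        rw [extv_first hkd']
        simpa using hmem 1 zero_le_one le_rfl) K hK (by
        intro l hl
        rw [Finset.mem_singleton] at hl
        subst hl
        rw [abs_pos]
        intro h0
        have hE : intVec (extv u (-n) : Fin k → ℤ) ∈ 𝒟.E := by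
          have h2 : 𝒟.rhoStar (intVec (extv u (-n))) = 0 := by
            ext l
            by_cases hl : (l : ℕ) < d
            · exact 𝒟.rho_decomp _ l hl
            · have : l = i := by
                apply Fin.ext
                have := l.2
                simp only [hi]
                omega
              rw [this]; exact h0
          rw [rhoStar, sub_eq_zero] at h2
          rw [h2]; exact 𝒟.rho_mem _
        have h3 := 𝒟.periodic_zero ha _ hE
        have h4 := congrFun h3 ⟨j', j'.2.trans hkd'⟩
        simp [extv, huj] at h4) (by
        intro l hl
        rw [Finset.mem_singleton] at hl
        subst hl
        rw [hform, abs_neg]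
        exact hx)
    simpa using this
  obtain ⟨K, hK⟩ := exists_nat_gt (A + B)
  have h0 : (0 : ℝ) < K := by linarith
  linarith [key K (by exact_mod_cast h0)]

end CPS

/-- For all integers `k > d ≥ 1` with `(k,d) ≠ (2,1)`, there is no `k` to `d`
cubical cut and project set which is LR with respect to `𝒞_d`. -/
theorem no_cubical_LR_wrt_Cd (k d : ℕ) (hd : 1 ≤ d) (hkd : d < k)
    (hne : ¬(k = 2 ∧ d = 1)) (𝒟 : CPS k d) (h : 𝒟.IsCubicalCPSet) :
    ¬ 𝒟.IsLR (CdCollection d) := by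
  by_cases h2 : d + 2 ≤ k
  · exact 𝒟.caseA hd h2 h.1
  · exact 𝒟.caseB (by omega) (by omega) h.1 h.2.2
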